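/- The incidence matrix of a bipartite graph extended by an all-ones row is totally unimodular. -/

import Mathlib

lemma aux_dir {α : Type*} [DecidableEq α] (k : ℕ) : ∀ (r : Fin k → α) (_ : Function.Injective r)
    (p q : Fin k → α) (M : Matrix (Fin k) (Fin k) ℚ)
    (_ : ∀ i j, M i j = (if r i = p j then 1 else 0) - (if r i = q j then 1 else 0)),
    M.det = 0 ∨ M.det = 1 ∨ M.det = -1 := by
  induction k with
  | zero => intro r hr p q M hM; simp
  | succ k ih =>
    intro r hr p q M hM
    by_cases h : ∃ j i0, ∀ i, i ≠ i0 → M i j = 0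
    · obtain ⟨j, i0, h⟩ := h
      rw [Matrix.det_succ_column M j, Finset.sum_eq_single i0]
      · have h1 := ih (r ∘ i0.succAbove) (hr.comp Fin.succAbove_right_injective)
          (p ∘ j.succAbove) (q ∘ j.succAbove) (M.submatrix i0.succAbove j.succAbove)
          (by intro a b; simp [hM])
        have h2 : M i0 j = 0 ∨ M i0 j = 1 ∨ M i0 j = -1 := by
          rw [hM]; split_ifs <;> simp
        rcases neg_one_pow_eq_or ℚ ((i0 : ℕ) + j) with h3 | h3 <;>
        rcases h1 with h1 | h1 | h1 <;> rcases h2 with h2 | h2 | h2 <;>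
        rw [h1, h2, h3] <;> norm_num
      · intro b _ hb; rw [h b hb]; simp
      · simp
    · push Not at h
      left
      have key : ∀ j, ∑ i, M i j = 0 := by
        intro j
        have hp : ∃ a, r a = p j := by
          by_contra hc
          push Not at hc
          by_cases hq : ∃ b, r b = q j
          · obtain ⟨b, hb⟩ := hq
            obtain ⟨i, hi, hne⟩ := h j b
            apply hne
            rw [hM, if_neg (hc i), if_neg (fun h => hi (hr (h.trans hb.symm)))]; simp
          · push Not at hq
            obtain ⟨i, hi, hne⟩ := h j 0
            apply hne
            rw [hM, if_neg (hc i), if_neg (hq i)]; simp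
        obtain ⟨a, ha⟩ := hp
        have hq : ∃ b, r b = q j := by
          by_contra hc
          push Not at hc
          obtain ⟨i, hi, hne⟩ := h j a
          apply hne
          rw [hM, if_neg (hc i), if_neg (fun h => hi (hr (h.trans ha.symm)))]; simp
        obtain ⟨b, hb⟩ := hq
        simp only [hM, ← ha, ← hb, hr.eq_iff, Finset.sum_sub_distrib]
        simp
      apply Matrix.exists_vecMul_eq_zero_iff.mp
      refine ⟨fun _ => 1, ?_, ?_⟩
      · intro h0
        have := congrFun h0 0
        simp at this
      · ext j
        simpa [Matrix.vecMul, dotProduct] using key j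

lemma aux_sgn {α : Type*} [DecidableEq α] (k : ℕ) (r : Fin k → α) (hr : Function.Injective r)
    (p q : Fin k → α) (s : Fin k → ℚ) (hs : ∀ i, s i = 1 ∨ s i = -1)
    (M : Matrix (Fin k) (Fin k) ℚ)
    (hM : ∀ i j, M i j = s i * ((if r i = p j then 1 else 0) - (if r i = q j then 1 else 0))) :
    M.det = 0 ∨ M.det = 1 ∨ M.det = -1 := by
  have h1 : M = Matrix.of (fun i j => s i * (Matrix.of (fun i j =>
      ((if r i = p j then (1 : ℚ) else 0) - (if r i = q j then 1 else 0)))) i j) := by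
    ext i j; simp [hM]
  have h2 : ∏ i, s i = 1 ∨ ∏ i, s i = -1 := by
    apply Finset.prod_induction s (fun x => x = 1 ∨ x = -1)
    · rintro a b (rfl | rfl) (rfl | rfl) <;> norm_num
    · simp
    · intro i _; exact hs i
  rw [h1, Matrix.det_mul_column]
  have h3 := aux_dir k r hr p q (Matrix.of (fun i j =>
      ((if r i = p j then (1 : ℚ) else 0) - (if r i = q j then 1 else 0)))) (fun _ _ => rfl)
  rcases h2 with h2 | h2 <;> rcases h3 with h3 | h3 | h3 <;> rw [h2, h3] <;> norm_num

/-- The vertex-edge incidence matrix of a bipartite graph (vertices `U ⊕ W`, each edge `e`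
having endpoints `(ends e).1 ∈ U` and `(ends e).2 ∈ W`), extended by an all-ones row,
is totally unimodular. -/
theorem stmt_14 {U W E : Type*} [DecidableEq U] [DecidableEq W]
    (ends : E → U × W) :
    (Matrix.of (fun r e =>
      match r with
      | some (Sum.inl u) => if (ends e).1 = u then (1 : ℚ) else 0
      | some (Sum.inr w) => if (ends e).2 = w then (1 : ℚ) else 0
      | none => 1) : Matrix (Option (U ⊕ W)) E ℚ).IsTotallyUnimodular := by
  classical
  intro k f g hf hg
  generalize hS : Matrix.submatrix _ f g = S
  have hS1 : ∀ i j u, f i = some (Sum.inl u) → S i j = if (ends (g j)).1 = u then 1 else 0 := by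
    intro i j u h; simp [← hS, h]
  have hS2 : ∀ i j w, f i = some (Sum.inr w) → S i j = if (ends (g j)).2 = w then 1 else 0 := by
    intro i j u h; simp [← hS, h]
  have hS3 : ∀ i j, f i = none → S i j = 1 := by
    intro i j h; simp [← hS, h]
  clear hS
  suffices h : S.det = 0 ∨ S.det = 1 ∨ S.det = -1 by
    rcases h with h | h | h
    · exact ⟨0, by simp [h]⟩
    · exact ⟨1, by simp [h]⟩
    · exact ⟨-1, by simp [h]⟩
  let p : Fin k → Option (U ⊕ W) := fun j =>
    if ∃ i, f i = some (Sum.inl (ends (g j)).1) then some (Sum.inl (ends (g j)).1) else none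
  let q : Fin k → Option (U ⊕ W) := fun j => some (Sum.inr (ends (g j)).2)
  let s : Fin k → ℚ := fun i => if ∃ w, f i = some (Sum.inr w) then -1 else 1
  have hs : ∀ i, s i = 1 ∨ s i = -1 := by
    intro i; simp only [s]; split_ifs <;> simp
  have hne : ∀ i j, f i ≠ none →
      S i j = s i * ((if f i = p j then 1 else 0) - (if f i = q j then 1 else 0)) := by
    intro i j hi
    rcases hfi : f i with _ | u | w
    · exact absurd hfi hi
    · rw [hS1 i j u hfi]
      by_cases hu : (ends (g j)).1 = u
      · have : ∃ i, f i = some (Sum.inl (ends (g j)).1) := ⟨i, by rw [hfi, hu]⟩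
        simp [s, p, q, hfi, hu, if_pos (⟨i, hfi⟩ : ∃ i, f i = some (Sum.inl u))]
      · have : some (Sum.inl u) ≠ p j := by
          simp only [p]; split_ifs
          · simpa using Ne.symm hu
          · simp
        simp [s, q, hfi, hu, this]
    · rw [hS2 i j w hfi]
      have : some (Sum.inr w) ≠ p j := by
        simp only [p]; split_ifs <;> simp
      simp [s, q, hfi, this, eq_comm]
      split_ifs <;> simp
  by_cases h0 : ∃ i0, f i0 = none
  · obtain ⟨i0, h0⟩ := h0
    let c : Fin k → ℚ := fun i => if i = i0 then 1 else if ∃ u, f i = some (Sum.inl u) then -1 else 0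
    have hd := Matrix.det_updateRow_sum S i0 c
    have hc : c i0 = 1 := by simp [c]
    rw [hc, one_smul] at hd
    rw [← hd]
    apply aux_sgn k f hf p q s hs
    intro i j
    by_cases hi : i = i0
    · subst hi
      have hsum : ∑ x, c x * S x j = 1 - ∑ x, (if f x = some (Sum.inl (ends (g j)).1) then 1 else 0) := by
        rw [eq_sub_iff_add_eq, ← Finset.sum_add_distrib, Finset.sum_eq_single i]
        · simp [hc, h0, hS3 i j h0]
        · intro b _ hb
          rcases hfb : f b with _ | u | w
          · exact absurd (hf (hfb.trans h0.symm)) hb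
          · rw [hS1 b j u hfb]
            simp only [c, hb, hfb]
            by_cases hu : (ends (g j)).1 = u
            · simp [hu]
            · simp [hu, Ne.symm hu]
          · simp [c, hb, hfb]
        · simp
      have hL : (S.updateRow i (∑ x, c x • S x)) i j = ∑ x, c x * S x j := by
        simp [Finset.sum_apply]
      rw [hL, hsum]
      by_cases hex : ∃ a, f a = some (Sum.inl (ends (g j)).1)
      · have hp : p j = some (Sum.inl (ends (g j)).1) := if_pos hex
        obtain ⟨a, ha⟩ := hex
        rw [hp, ← ha]
        simp only [hf.eq_iff]
        have : i ≠ a := by rintro rfl; rw [h0] at ha; cases ha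
        simp [this, q, h0]
      · have hp : p j = none := if_neg hex
        push Not at hex
        simp [hp, h0, q, s, hex]
    · rw [Matrix.updateRow_ne hi]
      exact hne i j (fun h => hi (hf (h.trans h0.symm)))
  · push Not at h0
    exact aux_sgn k f hf p q s hs S (fun i j => hne i j (h0 i))
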